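/- Let H be a finite-dimensional Hilbert space with inner product (·,·) and norm |·|, let Φ : H → H be continuous, and suppose there is a constant μ > 0 such that (Φ(f), f) ≥ 0 for all f ∈ H with |f| = μ. Then there exists f ∈ H with Φ(f) = 0 and |f| ≤ μ. -/

import Mathlib

open scoped RealInnerProductSpace

section PolynomialVolume

open MeasureTheory Set Metric Polynomial

variable {E : Type*} [NormedAddCommGroup E] [NormedSpace ℝ E] [FiniteDimensional ℝ E]

/-- The determinant of `1 + t • A` is polynomial in `t`, of degree at most the dimension. -/
theorem exists_polynomial_eval_eq_det_one_add_smul (A : E →L[ℝ] E) :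
    ∃ p : ℝ[X], p.degree < (Module.finrank ℝ E + 1 : ℕ) ∧
      ∀ t : ℝ, p.eval t = (1 + t • A).det := by
  let b := Module.finBasis ℝ E
  let M := LinearMap.toMatrix b b (A : E →ₗ[ℝ] E)
  refine ⟨((X : ℝ[X]) • M.map C + (1 : Matrix _ _ ℝ).map C).det, ?_, fun t => ?_⟩
  · refine degree_le_natDegree.trans_lt ?_
    have := natDegree_det_X_add_C_le M 1
    rw [Fintype.card_fin] at this
    exact_mod_cast Nat.lt_succ_of_le this
  · have h : LinearMap.toMatrix b b ((1 + t • A : E →L[ℝ] E) : E →ₗ[ℝ] E) = t • M + 1 := by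
      rw [add_comm]
      simp [M, ContinuousLinearMap.toLinearMap_add, ContinuousLinearMap.toLinearMap_smul,
        LinearMap.toMatrix_one]
    rw [ContinuousLinearMap.det, ← LinearMap.det_toMatrix b, h, ← coe_evalRingHom, RingHom.map_det]
    congr 1
    ext i j
    rcases eq_or_ne i j with rfl | hij
    · simp [mul_comm t]
    · simp [hij, mul_comm t]

/-- Finitely many small values of `t` determine the value at `1` of all polynomials
`t ↦ det (1 + t • A)` through a universal affine combination. -/
theorem exists_weights_det_one_add {δ : ℝ} (hδ : 0 < δ) :
    ∃ (s : Finset ℕ) (v w : ℕ → ℝ), (∀ i, 0 < v i ∧ v i ≤ δ) ∧ ∑ i ∈ s, w i = 1 ∧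
      ∀ A : E →L[ℝ] E, (1 + A).det = ∑ i ∈ s, w i * (1 + v i • A).det := by
  let s := Finset.range (Module.finrank ℝ E + 1)
  let v : ℕ → ℝ := fun i => δ / (i + 1)
  have hv : InjOn v s := by
    intro i _ j _ hij
    have h1 : (i : ℝ) + 1 ≠ 0 := by positivity
    have h2 : (j : ℝ) + 1 ≠ 0 := by positivity
    simp only [v] at hij
    field_simp at hij
    have : (j : ℝ) = i := by linarith
    exact_mod_cast this.symm
  refine ⟨s, v, fun i => (Lagrange.basis s v i).eval 1, fun i => ⟨by positivity, ?_⟩, ?_, ?_⟩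
  · exact div_le_self hδ.le (by simp)
  · rw [← eval_finsetSum, Lagrange.sum_basis hv ⟨0, by simp [s]⟩, eval_one]
  · intro A
    obtain ⟨p, hp, hpe⟩ := exists_polynomial_eval_eq_det_one_add_smul A
    have h := congrArg (eval 1) (Lagrange.eq_interpolate hv (by simpa [s] using hp))
    rw [Lagrange.interpolate_apply, eval_finsetSum, hpe, one_smul] at h
    rw [h]
    exact Finset.sum_congr rfl fun i _ => by rw [eval_mul, eval_C, hpe, mul_comm]

/-- A small Lipschitz perturbation of the identity supported in a ball maps the ball bijectively
onto itself. -/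
theorem bijOn_ball_id_add_smul {g : E → E} {K : NNReal} (hg : LipschitzWith K g) {r : ℝ}
    (hg0 : ∀ x ∉ ball (0 : E) r, g x = 0) {t : ℝ} (ht : 0 ≤ t) (htK : t * K < 1) :
    BijOn (fun x => x + t • g x) (ball 0 r) (ball 0 r) := by
  let F : E → E := fun x => x + t • g x
  have hF : ApproximatesLinearOn F ((ContinuousLinearEquiv.refl ℝ E : E ≃L[ℝ] E) : E →L[ℝ] E)
      univ (t.toNNReal * K) := by
    intro x _ y _
    have : F x - F y - (x - y) = t • (g x - g y) := by simp only [F, smul_sub]; abel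
    simp only [ContinuousLinearEquiv.coe_refl, ContinuousLinearMap.id_apply, this]
    rw [norm_smul, Real.norm_of_nonneg ht, NNReal.coe_mul, Real.coe_toNNReal t ht, mul_assoc]
    exact mul_le_mul_of_nonneg_left (hg.norm_sub_le x y) ht
  have hc : Subsingleton E ∨ t.toNNReal * K <
      ‖((ContinuousLinearEquiv.refl ℝ E).symm : E →L[ℝ] E)‖₊⁻¹ := by
    rcases subsingleton_or_nontrivial E with h | h
    · exact Or.inl h
    · right
      have : ‖((ContinuousLinearEquiv.refl ℝ E).symm : E →L[ℝ] E)‖₊ = 1 := by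
        ext; exact ContinuousLinearMap.norm_id
      rw [this, inv_one, ← NNReal.coe_lt_coe, NNReal.coe_mul, Real.coe_toNNReal t ht]
      exact htK
  have hinj : Function.Injective F := (hF.toHomeomorph F hc).injective
  have hsurj : Function.Surjective F := (hF.toHomeomorph F hc).surjective
  have hout : ∀ x ∉ ball (0 : E) r, F x = x := fun x hx => by simp [F, hg0 x hx]
  refine ⟨fun x hx => ?_, hinj.injOn, fun y hy => ?_⟩
  · by_contra h
    have hfix : F x = x := hinj (hout _ h)
    exact h (show F x ∈ ball 0 r by rwa [hfix])
  · obtain ⟨x, rfl⟩ := hsurj y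
    refine ⟨x, ?_, rfl⟩
    by_contra h
    exact h (hout x h ▸ hy)

/-- A Lipschitz map `x ↦ x + g x` that is the identity off a ball and differentiable inside it
has somewhere in the ball an invertible derivative. -/
theorem exists_det_one_add_fderiv_ne_zero {g : E → E} {K : NNReal} (hg : LipschitzWith K g)
    {r : ℝ} (hr : 0 < r) (hg0 : ∀ x ∉ ball (0 : E) r, g x = 0)
    (hd : ∀ x ∈ ball (0 : E) r, DifferentiableAt ℝ g x) :
    ∃ x ∈ ball (0 : E) r, (1 + fderiv ℝ g x).det ≠ 0 := by
  let _ : MeasurableSpace E := borel E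
  have _ : BorelSpace E := ⟨rfl⟩
  let μ : Measure E := Measure.addHaar
  by_contra! hzero
  have hcont : Continuous fun A : E →L[ℝ] E => A.det := ContinuousLinearMap.continuous_det
  have hone : (1 : E →L[ℝ] E).det = 1 := by
    simp [ContinuousLinearMap.det, ContinuousLinearMap.one_def]
  obtain ⟨ε, hε, hnear⟩ := Metric.continuous_iff.1 hcont 1 1 one_pos
  have hK : (0 : ℝ) < K + 1 := by positivity
  obtain ⟨s, v, w, hv, hw, hdet⟩ := exists_weights_det_one_add (E := E)
    (δ := min ε 1 / (2 * (K + 1))) (by positivity)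
  have hsmall : ∀ i, v i * K < min ε 1 := fun i => by
    have h1 := (le_div_iff₀ (by positivity)).1 (hv i).2
    have h2 : 0 < min ε 1 := by positivity
    nlinarith [(hv i).1, K.coe_nonneg, mul_nonneg (hv i).1.le K.coe_nonneg]
  have hclose : ∀ i x, |(1 + v i • fderiv ℝ g x).det - 1| < 1 := fun i x => by
    have h := hnear (1 + v i • fderiv ℝ g x) (by
      rw [dist_eq_norm, add_sub_cancel_left, norm_smul, Real.norm_of_nonneg (hv i).1.le]
      exact ((mul_le_mul_of_nonneg_left (norm_fderiv_le_of_lipschitz ℝ hg) (hv i).1.le).trans_lt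
        (hsmall i)).trans_le (min_le_left _ _))
    rwa [hone, Real.dist_eq] at h
  have hpos : ∀ i x, 0 < (1 + v i • fderiv ℝ g x).det := fun i x => by
    linarith [(abs_lt.1 (hclose i x)).1]
  have hmeas : ∀ i, Measurable fun x => (1 + v i • fderiv ℝ g x).det := fun i =>
    hcont.measurable.comp (((measurable_fderiv ℝ g).const_smul (v i)).const_add 1)
  have hintegrable : ∀ i, IntegrableOn (fun x => (1 + v i • fderiv ℝ g x).det) (ball 0 r) μ :=
    fun i =>
    Measure.integrableOn_of_bounded (M := 2) measure_ball_lt_top.ne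
      (hmeas i).aestronglyMeasurable (ae_of_all _ fun x => by
        rw [Real.norm_of_nonneg (hpos i x).le]; linarith [(abs_lt.1 (hclose i x)).2])
  have hvol : ∀ i, ∫ x in ball 0 r, (1 + v i • fderiv ℝ g x).det ∂μ = μ.real (ball 0 r) := by
    intro i
    have hbij := bijOn_ball_id_add_smul hg hg0 (hv i).1.le
      ((hsmall i).trans_le (min_le_right _ _))
    have h := lintegral_abs_det_fderiv_eq_addHaar_image μ measurableSet_ball
      (f := fun x => x + v i • g x) (f' := fun x => 1 + v i • fderiv ℝ g x)
      (fun x hx => ((hasFDerivAt_id x).add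
        ((hd x hx).hasFDerivAt.const_smul (v i))).hasFDerivWithinAt) hbij.injOn
    rw [hbij.image_eq] at h
    rw [integral_eq_lintegral_of_nonneg_ae (ae_of_all _ fun x => (hpos i x).le)
      (hmeas i).aestronglyMeasurable, Measure.real, ← h]
    simp only [abs_of_pos (hpos i _)]
  have hball : 0 < μ.real (ball (0 : E) r) :=
    ENNReal.toReal_pos (measure_ball_pos μ 0 hr).ne' measure_ball_lt_top.ne
  have h0 : ∫ x in ball 0 r, (1 + fderiv ℝ g x).det ∂μ = 0 := by
    rw [setIntegral_congr_fun measurableSet_ball (g := fun _ => (0 : ℝ)) hzero]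
    exact integral_zero _ _
  simp_rw [fun x => hdet (fderiv ℝ g x)] at h0
  rw [integral_finsetSum _ fun i _ => (hintegrable i).const_mul (w i)] at h0
  simp_rw [integral_const_mul, hvol] at h0
  rw [← Finset.sum_mul, hw, one_mul] at h0
  exact hball.ne' h0

end PolynomialVolume

section Retraction

open Set Metric

/-- A map that is Lipschitz on a closed ball and vanishes on its sphere stays Lipschitz when
extended by zero. -/
theorem LipschitzOnWith.indicator_closedBall {E F : Type*} [NormedAddCommGroup E]
    [NormedSpace ℝ E] [NormedAddCommGroup F] {g : E → F} {K : NNReal} {r : ℝ}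
    (hg : LipschitzOnWith K g (closedBall 0 r)) (h0 : ∀ x, ‖x‖ = r → g x = 0) :
    LipschitzWith K ((closedBall (0 : E) r).indicator g) := by
  have key : ∀ x ∈ closedBall (0 : E) r, ∀ y ∉ closedBall (0 : E) r,
      dist (g x) 0 ≤ K * dist x y := by
    intro x hx y hy
    rw [mem_closedBall_zero_iff] at hx hy
    obtain ⟨t, ht, htr⟩ := intermediate_value_Icc (zero_le_one (α := ℝ))
      (f := fun t : ℝ => ‖AffineMap.lineMap x y t‖)
      (AffineMap.lineMap_continuous.norm.continuousOn)
      (show r ∈ _ by simpa using ⟨hx, (not_le.1 hy).le⟩)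
    have h := hg.dist_le_mul x (by simpa using hx) (AffineMap.lineMap x y t) (by simpa using htr.le)
    rw [h0 _ htr, dist_left_lineMap, Real.norm_of_nonneg ht.1] at h
    refine h.trans (mul_le_mul_of_nonneg_left ?_ K.coe_nonneg)
    exact mul_le_of_le_one_left dist_nonneg ht.2
  refine LipschitzWith.of_dist_le_mul fun x y => ?_
  by_cases hx : x ∈ closedBall (0 : E) r <;> by_cases hy : y ∈ closedBall (0 : E) r
  · simpa [indicator_of_mem hx, indicator_of_mem hy] using hg.dist_le_mul x hx y hy
  · simpa only [indicator_of_mem hx, indicator_of_notMem hy] using key x hx y hy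
  · simpa only [indicator_of_notMem hx, indicator_of_mem hy, dist_comm] using key y hy x hx
  · simp only [indicator_of_notMem hx, indicator_of_notMem hy, dist_self]
    positivity

variable {H : Type*} [NormedAddCommGroup H] [InnerProductSpace ℝ H] [FiniteDimensional ℝ H]

/-- There is no `C¹` retraction of a closed ball onto its sphere. -/
theorem not_contDiffOn_retraction {r : ℝ} (hr : 0 < r) {U : Set H} (hU : IsOpen U)
    (hUr : closedBall 0 r ⊆ U) {g : H → H} (hg : ContDiffOn ℝ 1 g U)
    (hsphere : ∀ x, ‖x‖ = r → g x = 0) (hnorm : ∀ x, ‖x‖ ≤ r → ‖x + g x‖ = r) : False := by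
  have hdiff : ∀ x ∈ closedBall (0 : H) r, DifferentiableAt ℝ g x := fun x hx =>
    (hg.differentiableOn one_ne_zero).differentiableAt (hU.mem_nhds (hUr hx))
  obtain ⟨C, hC⟩ := (isCompact_closedBall (0 : H) r).exists_bound_of_continuousOn
    ((hg.continuousOn_fderiv_of_isOpen hU le_rfl).mono hUr)
  have hlip : LipschitzOnWith C.toNNReal g (closedBall 0 r) :=
    (convex_closedBall 0 r).lipschitzOnWith_of_nnnorm_fderiv_le hdiff fun x hx => by
      rw [← NNReal.coe_le_coe]
      exact (hC x hx).trans (Real.le_coe_toNNReal C)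
  have heq : ∀ x ∈ ball (0 : H) r, (closedBall (0 : H) r).indicator g =ᶠ[nhds x] g := fun x hx =>
    Filter.eventually_of_mem (isOpen_ball.mem_nhds hx) fun y hy =>
      indicator_of_mem (ball_subset_closedBall hy) g
  obtain ⟨x, hx, hdet⟩ := exists_det_one_add_fderiv_ne_zero (hlip.indicator_closedBall hsphere) hr
    (fun x hx => by
      rw [mem_ball_zero_iff, not_lt] at hx
      rcases hx.eq_or_lt with h | h
      · simp [hsphere x h.symm]
      · exact indicator_of_notMem (by simpa using h) g)
    (fun x hx => (heq x hx).differentiableAt_iff.2 (hdiff x (ball_subset_closedBall hx)))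
  rw [(heq x hx).fderiv_eq] at hdet
  let A : H →L[ℝ] H := 1 + fderiv ℝ g x
  have hsurj : Function.Surjective A :=
    (LinearMap.equivOfDetNeZero (A : H →ₗ[ℝ] H) hdet).surjective
  have hder : HasFDerivAt (fun y => y + g y) A x :=
    (hasFDerivAt_id x).add (hdiff x (ball_subset_closedBall hx)).hasFDerivAt
  have hconst : HasFDerivAt (fun y => ‖y + g y‖ ^ 2) (0 : H →L[ℝ] ℝ) x :=
    (hasFDerivAt_const (r ^ 2) x).congr_of_eventuallyEq
      (Filter.eventually_of_mem (isOpen_ball.mem_nhds hx) fun y hy => by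
        simp only [hnorm y (mem_ball_zero_iff.1 hy).le])
  have h := hder.norm_sq.unique hconst
  obtain ⟨y, hy⟩ := hsurj (x + g x)
  have h2 : (2 : ℕ) • ⟪x + g x, A y⟫ = 0 := DFunLike.congr_fun h y
  have hx' := hnorm x (mem_ball_zero_iff.1 hx).le
  rw [hy, real_inner_self_eq_norm_sq, hx'] at h2
  simp [hr.ne'] at h2

/-- A smooth vector field pointing outwards on a sphere has a zero in the ball. -/
theorem exists_zero_of_contDiff_of_inner_pos {Ψ : H → H} (hΨ : ContDiff ℝ 1 Ψ) {r : ℝ}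
    (hr : 0 < r) (hpos : ∀ x, ‖x‖ = r → 0 < ⟪Ψ x, x⟫) : ∃ x, ‖x‖ ≤ r ∧ Ψ x = 0 := by
  by_contra! hne
  let disc : H → ℝ := fun x => ⟪Ψ x, x⟫ ^ 2 + ‖Ψ x‖ ^ 2 * (r ^ 2 - ‖x‖ ^ 2)
  let s : H → ℝ := fun x => (-⟪Ψ x, x⟫ + √(disc x)) / ‖Ψ x‖ ^ 2
  have hin : ContDiff ℝ 1 fun x => ⟪Ψ x, x⟫ := hΨ.inner ℝ contDiff_id
  have hsq : ContDiff ℝ 1 fun x => ‖Ψ x‖ ^ 2 := hΨ.norm_sq ℝ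
  have hdisc : ContDiff ℝ 1 disc :=
    (hin.pow 2).add (hsq.mul (contDiff_const.sub (contDiff_id.norm_sq ℝ)))
  have hU : IsOpen {x | Ψ x ≠ 0 ∧ 0 < disc x} :=
    (isOpen_ne_fun hΨ.continuous continuous_const).inter
      (isOpen_lt continuous_const hdisc.continuous)
  have hdpos : ∀ x, ‖x‖ ≤ r → 0 < disc x := by
    intro x hx
    have hp : 0 < ‖Ψ x‖ := norm_pos_iff.2 (hne x hx)
    rcases hx.eq_or_lt with h | h
    · have := hpos x h
      simp only [disc, h, sub_self, mul_zero, add_zero]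
      positivity
    · have : 0 < r ^ 2 - ‖x‖ ^ 2 := by nlinarith [norm_nonneg x]
      simp only [disc]
      positivity
  refine not_contDiffOn_retraction hr hU (g := fun x => s x • Ψ x)
    (fun x hx => ?_) (fun x hx => ?_) (fun x hx => ?_) (fun x hx => ?_)
  · rw [mem_closedBall_zero_iff] at hx
    exact ⟨hne x hx, hdpos x hx⟩
  · have hn : ‖Ψ x‖ ^ 2 ≠ 0 := pow_ne_zero 2 (norm_ne_zero_iff.2 hx.1)
    exact (((hin.contDiffAt.neg.add (hdisc.contDiffAt.sqrt hx.2.ne')).div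
      hsq.contDiffAt hn).smul hΨ.contDiffAt).contDiffWithinAt
  · have h : s x = 0 := by
      simp [s, disc, hx, Real.sqrt_sq (hpos x hx).le]
    simp [h]
  · have hn : ‖Ψ x‖ ^ 2 ≠ 0 := pow_ne_zero 2 (norm_ne_zero_iff.2 (hne x hx))
    have hq := Real.sq_sqrt (hdpos x hx).le
    have hs : s x * ‖Ψ x‖ ^ 2 = -⟪Ψ x, x⟫ + √(disc x) := div_mul_cancel₀ _ hn
    rw [← sq_eq_sq₀ (norm_nonneg _) hr.le, norm_add_sq_real, real_inner_smul_right, norm_smul,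
      mul_pow, Real.norm_eq_abs, sq_abs, real_inner_comm]
    have hd : disc x = ⟪Ψ x, x⟫ ^ 2 + ‖Ψ x‖ ^ 2 * (r ^ 2 - ‖x‖ ^ 2) := rfl
    refine mul_left_cancel₀ hn ?_
    rw [show √(disc x) = s x * ‖Ψ x‖ ^ 2 + ⟪Ψ x, x⟫ by linarith] at hq
    linear_combination hq + hd

end Retraction

/-- **Brouwer's fixed point theorem (Galerkin form).**
If `H` is a finite-dimensional real Hilbert space, `Φ : H → H` is continuous, and
`(Φ f, f) ≥ 0` for all `f` on the sphere of radius `μ > 0`, then `Φ` has a zero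
in the closed ball of radius `μ`. -/
theorem brouwer_zero_of_nonneg_on_sphere
    {H : Type*} [NormedAddCommGroup H] [InnerProductSpace ℝ H] [FiniteDimensional ℝ H]
    (Φ : H → H) (hΦ : Continuous Φ) (μ : ℝ) (hμ : 0 < μ)
    (hpos : ∀ f : H, ‖f‖ = μ → 0 ≤ ⟪Φ f, f⟫) :
    ∃ f : H, Φ f = 0 ∧ ‖f‖ ≤ μ := by
  by_contra! hne
  obtain ⟨x₀, hx₀, hmin⟩ := (isCompact_closedBall (0 : H) μ).exists_isMinOn
    ⟨0, by simp [hμ.le]⟩ hΦ.norm.continuousOn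
  rw [mem_closedBall_zero_iff] at hx₀
  set ε := ‖Φ x₀‖ / 3 with hε
  have hεpos : 0 < ε := by
    have : 0 < ‖Φ x₀‖ := norm_pos_iff.2 fun h => (hne x₀ h).not_ge hx₀
    positivity
  have hlow : ∀ x, ‖x‖ ≤ μ → 3 * ε ≤ ‖Φ x‖ := fun x hx => by
    have : ‖Φ x₀‖ ≤ ‖Φ x‖ := hmin (mem_closedBall_zero_iff.2 hx)
    linarith
  obtain ⟨Ψ, hΨ, hclose, -⟩ := (hΦ.add (continuous_id.const_smul (ε / μ))).exists_contDiff_approx 1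
    (ε := fun _ => ε) continuous_const fun _ => hεpos
  have hclose' : ∀ x, ‖Ψ x - (Φ x + (ε / μ) • x)‖ < ε := fun x => by
    simpa [dist_eq_norm] using hclose x
  obtain ⟨x, hx, hzero⟩ := exists_zero_of_contDiff_of_inner_pos (by exact_mod_cast hΨ) hμ
    fun x hx => by
      have h1 := (neg_le_abs _).trans (abs_real_inner_le_norm (Ψ x - (Φ x + (ε / μ) • x)) x)
      rw [inner_sub_left, inner_add_left, real_inner_smul_left, real_inner_self_eq_norm_sq, hx] at h1
      have h2 : ε / μ * μ ^ 2 = ε * μ := by field_simp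
      have h3 := mul_lt_mul_of_pos_right (hclose' x) hμ
      linarith [hpos x hx]
  have h1 := hclose' x
  rw [hzero, zero_sub, norm_neg] at h1
  have h2 : ‖(ε / μ) • x‖ ≤ ε := by
    rw [norm_smul, Real.norm_of_nonneg (by positivity), div_mul_eq_mul_div, div_le_iff₀ hμ]
    exact mul_le_mul_of_nonneg_left hx hεpos.le
  have h3 := norm_sub_le (Φ x + (ε / μ) • x) ((ε / μ) • x)
  rw [add_sub_cancel_right] at h3
  linarith [hlow x hx]
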